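/- arXiv:2205.03868 — 9 statements merged into one kernel-verified Lean document; each statement's English description precedes it below -/
import Mathlib

section
/- Let S be a finite partial order, and let M(S) be the square matrix over ℕ indexed by S with M(S)[i,j] = 1 if i ≤ j and 0 otherwise. Then the sum over all pairs (i,j) of the squares of the entries of M(S)^2 equals the number of monotone functions from Bool × Bool (componentwise order, false < true) to S. In the paper's notation: SumSq(M(S)^2) = |S^{B^2}|. -/
/-- A monotone map out of `Bool × Bool` amounts to a bottom value, a top value, and two values
lying between them. -/
def monotoneBoolProdEquiv (S : Type*) [Preorder S] :
    {f : Bool × Bool → S // Monotone f} ≃ Σ i : S, Σ j : S, Set.Icc i j × Set.Icc i j where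
  toFun f :=
    ⟨f.1 (false, false), f.1 (true, true),
      ⟨f.1 (false, true), f.2 (by decide), f.2 (by decide)⟩,
      ⟨f.1 (true, false), f.2 (by decide), f.2 (by decide)⟩⟩
  invFun x :=
    ⟨fun b => match b with
      | (false, false) => x.1
      | (false, true) => x.2.2.1
      | (true, false) => x.2.2.2
      | (true, true) => x.2.1, by
      obtain ⟨i, j, ⟨k, hik, hkj⟩, ⟨l, hil, hlj⟩⟩ := x
      rintro ⟨_ | _, _ | _⟩ ⟨_ | _, _ | _⟩ h <;>
        first
        | exact le_rfl
        | assumption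
        | exact hik.trans hkj
        | exact absurd h (by decide)⟩
  left_inv f := by
    ext ⟨_ | _, _ | _⟩ <;> rfl
  right_inv _ := rfl

/-- The square of the order matrix counts the elements of closed intervals. -/
theorem orderMatrix_sq_apply {S : Type*} [Preorder S] [Fintype S] [DecidableEq S]
    [DecidableRel ((· ≤ ·) : S → S → Prop)]
    (M : Matrix S S ℕ) (hM : ∀ i j : S, M i j = if i ≤ j then 1 else 0) (i j : S) :
    (M ^ 2) i j = Nat.card (Set.Icc i j) := by
  have hcard : Nat.card (Set.Icc i j) = Fintype.card {k : S // i ≤ k ∧ k ≤ j} :=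
    Nat.card_eq_fintype_card (α := {k : S // i ≤ k ∧ k ≤ j})
  rw [hcard, Fintype.card_subtype, Finset.card_filter, sq, Matrix.mul_apply]
  refine Finset.sum_congr rfl fun k _ => ?_
  rw [hM, hM, ite_and, ite_mul, one_mul, zero_mul]

/-- Let `S` be a finite partial order and `M` the `ℕ`-matrix with `M i j = 1` iff `i ≤ j`
(and `0` otherwise).  The sum of the squares of the entries of `M ^ 2` equals the number
of monotone functions from `Bool × Bool` (componentwise order, `false < true`) to `S`.
In the paper's notation: `SumSq(M(S)^2) = |S^{B^2}|`. -/
theorem sumSq_matrix_sq_eq_card_monotone_boolProd {S : Type*} [PartialOrder S] [Fintype S]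
    [DecidableEq S] [DecidableRel ((· ≤ ·) : S → S → Prop)]
    (M : Matrix S S ℕ) (hM : ∀ i j : S, M i j = if i ≤ j then 1 else 0) :
    ∑ i : S, ∑ j : S, ((M ^ 2) i j) ^ 2 =
      Nat.card {f : Bool × Bool → S // Monotone f} := by
  rw [Nat.card_congr (monotoneBoolProdEquiv S), Nat.card_sigma]
  refine Finset.sum_congr rfl fun i _ => ?_
  rw [Nat.card_sigma]
  refine Finset.sum_congr rfl fun j _ => ?_
  rw [orderMatrix_sq_apply M hM, Nat.card_prod, sq]
end

section
/- Let π be a permutation of Fin n, acting on B^n = (Fin n → Bool) by x ↦ x ∘ π, and consider the orbits of the cyclic group generated by this action on B^n (the cycles of π acting on B^n). Define a relation on the set of orbits by: C ≼ D iff there exist x ∈ C and y ∈ D with x ≤ y (pointwise order on Fin n → Bool with false < true). Then ≼ is a partial order on the set of orbits: it is reflexive, transitive, and antisymmetric. -/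
/-- The orbit (cycle) of `x : Fin n → Bool` under the action of the cyclic group
generated by the permutation of `B^n = Fin n → Bool` induced by `π` (acting by
`x ↦ x ∘ π`). -/
def cycleOf {n : ℕ} (π : Equiv.Perm (Fin n)) (x : Fin n → Bool) : Set (Fin n → Bool) :=
  {y | ∃ k : ℤ, y = x ∘ ⇑(π ^ k)}

/-- The set of cycles of `π` acting on `B^n`, denoted `Cycl(π, B^n)` in the paper. -/
def cycles {n : ℕ} (π : Equiv.Perm (Fin n)) : Set (Set (Fin n → Bool)) :=
  {C | ∃ x, C = cycleOf π x}

/-- The relation `C ≼ D` iff some `x ∈ C` and `y ∈ D` satisfy `x ≤ y` (pointwise,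
with `false < true`). -/
def cycleLE {n : ℕ} (C D : Set (Fin n → Bool)) : Prop :=
  ∃ x ∈ C, ∃ y ∈ D, x ≤ y

theorem self_mem_cycleOf {n : ℕ} (π : Equiv.Perm (Fin n)) (x : Fin n → Bool) :
    x ∈ cycleOf π x :=
  ⟨0, by simp⟩

theorem cycleOf_comp_zpow {n : ℕ} (π : Equiv.Perm (Fin n)) (x : Fin n → Bool) (k : ℤ) :
    cycleOf π (x ∘ ⇑(π ^ k)) = cycleOf π x := by
  ext y
  constructor
  · rintro ⟨l, rfl⟩
    exact ⟨k + l, by rw [zpow_add, Equiv.Perm.coe_mul, Function.comp_assoc]⟩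
  · rintro ⟨l, rfl⟩
    refine ⟨l - k, ?_⟩
    rw [Function.comp_assoc, ← Equiv.Perm.coe_mul, ← zpow_add, add_sub_cancel]

theorem cycleLE_cycleOf_iff {n : ℕ} (π : Equiv.Perm (Fin n)) (x y : Fin n → Bool) :
    cycleLE (cycleOf π x) (cycleOf π y) ↔ ∃ k : ℤ, x ≤ y ∘ ⇑(π ^ k) := by
  constructor
  · rintro ⟨_, ⟨k, rfl⟩, _, ⟨l, rfl⟩, h⟩
    refine ⟨l - k, fun i => ?_⟩
    simpa [zpow_sub] using h ((π ^ k)⁻¹ i)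
  · rintro ⟨k, h⟩
    exact ⟨x, self_mem_cycleOf π x, _, ⟨k, rfl⟩, h⟩

/-- Permuting coordinates preserves the number of `true` entries, so two vectors that lie
below permutations of each other are equal up to these permutations. -/
theorem eq_comp_perm_of_le_of_le {ι : Type*} [Fintype ι] {x y : ι → Bool}
    {σ τ : Equiv.Perm ι} (hxy : x ≤ y ∘ ⇑σ) (hyx : y ≤ x ∘ ⇑τ) : x = y ∘ ⇑σ := by
  have hle : ∀ i ∈ Finset.univ, (x i).toNat ≤ (y (σ i)).toNat :=
    fun i _ => Bool.toNat_le_toNat (hxy i)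
  have hsum : ∑ i, (y (σ i)).toNat ≤ ∑ i, (x i).toNat := by
    rw [Equiv.sum_comp σ fun i => (y i).toNat, ← Equiv.sum_comp τ fun i => (x i).toNat]
    exact Finset.sum_le_sum fun i _ => Bool.toNat_le_toNat (hyx i)
  funext i
  exact Function.LeftInverse.injective Bool.ofNat_toNat <|
    (Finset.sum_eq_sum_iff_of_le hle).1 ((Finset.sum_le_sum hle).antisymm hsum) i
      (Finset.mem_univ i)

/-- The relation `≼` on the set of cycles of `π` acting on `B^n` is a partial order:
it is reflexive, transitive and antisymmetric. -/
theorem cycleLE_partialOrder {n : ℕ} (π : Equiv.Perm (Fin n)) :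
    (∀ C ∈ cycles π, cycleLE C C) ∧
    (∀ C ∈ cycles π, ∀ D ∈ cycles π, ∀ E ∈ cycles π,
      cycleLE C D → cycleLE D E → cycleLE C E) ∧
    (∀ C ∈ cycles π, ∀ D ∈ cycles π, cycleLE C D → cycleLE D C → C = D) := by
  refine ⟨?_, ?_, ?_⟩
  · rintro _ ⟨x, rfl⟩
    exact ⟨x, self_mem_cycleOf π x, x, self_mem_cycleOf π x, le_rfl⟩
  · rintro _ ⟨x, rfl⟩ _ ⟨y, rfl⟩ _ ⟨z, rfl⟩ hxy hyz
    rw [cycleLE_cycleOf_iff] at *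
    obtain ⟨k, hk⟩ := hxy
    obtain ⟨l, hl⟩ := hyz
    refine ⟨l + k, fun i => ?_⟩
    rw [zpow_add]
    exact (hk i).trans (hl ((π ^ k) i))
  · rintro _ ⟨x, rfl⟩ _ ⟨y, rfl⟩ hxy hyx
    rw [cycleLE_cycleOf_iff] at hxy hyx
    obtain ⟨k, hk⟩ := hxy
    obtain ⟨l, hl⟩ := hyx
    rw [eq_comp_perm_of_le_of_le hk hl, cycleOf_comp_zpow]
end

section
/- Let n = k + m and let π be a permutation of Fin k, acting on B^k = (Fin k → Bool) by x ↦ x ∘ π and hence on the monotone Boolean functions D_k by f ↦ f ∘ (π-action). Identify B^n with (Fin k → Bool) × (Fin m → Bool) and let π' act on it by (x, y) ↦ (x ∘ π, y). Then the subposet of D_n consisting of monotone F : B^n → Bool fixed by π' (i.e., F(x ∘ π, y) = F(x, y) for all x, y) is order-isomorphic to the poset of monotone maps from (Fin m → Bool) (pointwise order) to Fix(π, D_k) (pointwise order), via F ↦ (y ↦ (x ↦ F(x, y))). In the paper's notation: Fix(π, D_n) = (Fix(π, D_k))^{B^m}. -/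
/-- Let `π` be a permutation of `Fin k`, acting on `B^k = Fin k → Bool` by `x ↦ x ∘ π`.
Identifying `B^(k+m)` with `(Fin k → Bool) × (Fin m → Bool)`, with `π` acting by
`(x, y) ↦ (x ∘ π, y)`, the subposet of `D_{k+m}` consisting of the monotone functions
fixed by this action is order-isomorphic to the poset of monotone maps from
`B^m = Fin m → Bool` to `Fix(π, D_k)`, via `F ↦ (y ↦ (x ↦ F (x, y)))`.
In the paper's notation: `Fix(π, D_n) = (Fix(π, D_k))^{B^m}` where `n = k + m`. -/
theorem fix_orderIso_orderHom_pow {k m : ℕ} (π : Equiv.Perm (Fin k)) :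
    ∃ e : {F : ((Fin k → Bool) × (Fin m → Bool)) →o Bool //
            ∀ (x : Fin k → Bool) (y : Fin m → Bool), F (x ∘ ⇑π, y) = F (x, y)} ≃o
          ((Fin m → Bool) →o
            {f : (Fin k → Bool) →o Bool // ∀ x : Fin k → Bool, f (x ∘ ⇑π) = f x}),
      ∀ F (y : Fin m → Bool) (x : Fin k → Bool), ((e F) y).1 x = F.1 (x, y) := by
  refine ⟨
    { toFun := fun F =>
        ⟨fun y => ⟨⟨fun x => F.1 (x, y), fun _ _ h => F.1.monotone ⟨h, le_rfl⟩⟩,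
            fun x => F.2 x y⟩,
          fun _ _ h x => F.1.monotone ⟨le_refl x, h⟩⟩
      invFun := fun G =>
        ⟨⟨fun p => (G p.2).1 p.1,
            fun _ q h => ((G _).1.monotone h.1).trans (G.monotone h.2 q.1)⟩,
          fun x y => (G y).2 x⟩
      left_inv := fun _ => rfl
      right_inv := fun _ => rfl
      map_rel_iff' := ⟨fun h p => h p.2 p.1, fun h y x => h (x, y)⟩ },
    fun _ _ _ => rfl⟩
end

section
/- Let π be a permutation of Fin n with π ∘ π = id, acting on B^n = (Fin n → Bool) by x ↦ x ∘ π and on D_n by (π·f)(x) = f(x ∘ π). Identify B^{n+2} with (Fin n → Bool) × Bool × Bool and let σ act on it by (x, a, b) ↦ (x ∘ π, b, a). Then the number of monotone F : B^{n+2} → Bool fixed by σ equals the sum, over all f ∈ D_n, of the product |{g ∈ Fix(π, D_n) : g ≤ f ⊓ (π·f)}| · |{g ∈ Fix(π, D_n) : g ≥ f ⊔ (π·f)}|, where ⊓ and ⊔ are the pointwise meet and join of Boolean functions. -/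
section TwistedSquare

variable {X : Type*} [Preorder X] (s : X → X)

/-- The function on `X × Bool × Bool` glued from its restrictions `g` to `(false, false)`, `f` to
`(false, true)`, `f ∘ s` to `(true, false)` and `h` to `(true, true)`. -/
def twistedGlue (f g h : X → Bool) : X × Bool × Bool → Bool
  | (x, false, false) => g x
  | (x, false, true) => f x
  | (x, true, false) => f (s x)
  | (x, true, true) => h x

variable {s}

theorem monotone_twistedGlue (hs : Monotone s) {f g h : X → Bool}
    (hf : Monotone f) (hg : Monotone g) (hh : Monotone h)
    (hgf : g ≤ fun x => f x ⊓ f (s x)) (hfh : (fun x => f x ⊔ f (s x)) ≤ h) :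
    Monotone (twistedGlue s f g h) := by
  have hgf₁ x : g x ≤ f x := (hgf x).trans inf_le_left
  have hgf₂ x : g x ≤ f (s x) := (hgf x).trans inf_le_right
  have hfh₁ x : f x ≤ h x := le_sup_left.trans (hfh x)
  have hfh₂ x : f (s x) ≤ h x := le_sup_right.trans (hfh x)
  rintro ⟨x, a, b⟩ ⟨y, c, d⟩ ⟨hxy : x ≤ y, hac : a ≤ c, hbd : b ≤ d⟩
  match a, b, c, d, hac, hbd with
  | false, false, false, false, _, _ => exact hg hxy
  | false, false, false, true, _, _ => exact (hgf₁ x).trans (hf hxy)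
  | false, false, true, false, _, _ => exact (hgf₂ x).trans (hf (hs hxy))
  | false, false, true, true, _, _ => exact ((hgf₁ x).trans (hfh₁ x)).trans (hh hxy)
  | false, true, false, true, _, _ => exact hf hxy
  | false, true, true, true, _, _ => exact (hfh₁ x).trans (hh hxy)
  | true, false, true, false, _, _ => exact hf (hs hxy)
  | true, false, true, true, _, _ => exact (hfh₂ x).trans (hh hxy)
  | true, true, true, true, _, _ => exact hh hxy

/-- Monotone functions on `X × Bool × Bool` invariant under `(x, a, b) ↦ (s x, b, a)`, for a monotone
involution `s`, correspond to a monotone `f` on `X` together with two monotone `s`-invariant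
functions, one below `f ⊓ f ∘ s` and one above `f ⊔ f ∘ s`. -/
def twistedFixEquiv (hs : Monotone s) (hinv : Function.Involutive s) :
    {F : X × Bool × Bool → Bool // Monotone F ∧ ∀ x a b, F (s x, b, a) = F (x, a, b)} ≃
      Σ f : {f : X → Bool // Monotone f},
        {g : X → Bool // (Monotone g ∧ ∀ x, g (s x) = g x) ∧ g ≤ fun x => f.1 x ⊓ f.1 (s x)} ×
        {g : X → Bool // (Monotone g ∧ ∀ x, g (s x) = g x) ∧
          (fun x => f.1 x ⊔ f.1 (s x)) ≤ g} where
  toFun F :=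
    have hslice (a b) : Monotone fun x => F.1 (x, a, b) :=
      fun _ _ hxy => F.2.1 ⟨hxy, le_rfl, le_rfl⟩
    have hle (x) {a b c d : Bool} (hac : a ≤ c) (hbd : b ≤ d) : F.1 (x, a, b) ≤ F.1 (x, c, d) :=
      F.2.1 ⟨le_rfl, hac, hbd⟩
    ⟨⟨fun x => F.1 (x, false, true), hslice _ _⟩,
      ⟨fun x => F.1 (x, false, false), ⟨hslice _ _, fun x => F.2.2 x _ _⟩,
        fun x => le_inf (hle x le_rfl (Bool.false_le _))
          ((hle x (Bool.false_le _) le_rfl).trans_eq (F.2.2 x true false).symm)⟩,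
      ⟨fun x => F.1 (x, true, true), ⟨hslice _ _, fun x => F.2.2 x _ _⟩,
        fun x => sup_le (hle x (Bool.false_le _) le_rfl)
          ((F.2.2 x true false).trans_le (hle x le_rfl (Bool.false_le _)))⟩⟩
  invFun p :=
    ⟨twistedGlue s p.1.1 p.2.1.1 p.2.2.1,
      monotone_twistedGlue hs p.1.2 p.2.1.2.1.1 p.2.2.2.1.1 p.2.1.2.2 p.2.2.2.2, by
        rintro x (_ | _) (_ | _)
        · exact p.2.1.2.1.2 x
        · exact congrArg p.1.1 (hinv x)
        · rfl
        · exact p.2.2.2.1.2 x⟩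
  left_inv F := by
    ext ⟨x, a, b⟩
    match a, b with
    | false, false => rfl
    | false, true => rfl
    | true, false => exact F.2.2 x true false
    | true, true => rfl
  right_inv _ := rfl

end TwistedSquare


open scoped Classical in
/-- Correctness of the paper's fix-counting algorithm.  Let `π` be an involution of
`Fin n`, acting on `B^n = Fin n → Bool` by `x ↦ x ∘ π` and on `D_n` by
`(π·f)(x) = f (x ∘ π)`.  Identify `B^(n+2)` with `(Fin n → Bool) × Bool × Bool` and let
`σ` act by `(x, a, b) ↦ (x ∘ π, b, a)`.  Then the number of monotone functions
`F : B^(n+2) → Bool` fixed by `σ` equals the sum, over all monotone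
`f : B^n → Bool`, of
`|{g ∈ Fix(π, D_n) : g ≤ f ⊓ π·f}| * |{g ∈ Fix(π, D_n) : g ≥ f ⊔ π·f}|`. -/
theorem fix_count_algorithm {n : ℕ} (π : Equiv.Perm (Fin n)) (hπ : ⇑π ∘ ⇑π = id) :
    Nat.card {F : ((Fin n → Bool) × Bool × Bool) → Bool //
        Monotone F ∧ ∀ (x : Fin n → Bool) (a b : Bool), F (x ∘ ⇑π, b, a) = F (x, a, b)} =
      ∑ f : {f : (Fin n → Bool) → Bool // Monotone f},
        Nat.card {g : (Fin n → Bool) → Bool //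
            (Monotone g ∧ ∀ x, g (x ∘ ⇑π) = g x) ∧
              g ≤ fun x => f.1 x ⊓ f.1 (x ∘ ⇑π)} *
        Nat.card {g : (Fin n → Bool) → Bool //
            (Monotone g ∧ ∀ x, g (x ∘ ⇑π) = g x) ∧
              (fun x => f.1 x ⊔ f.1 (x ∘ ⇑π)) ≤ g} := by
  have hs : Monotone fun x : Fin n → Bool => x ∘ ⇑π := fun _ _ hxy i => hxy (π i)
  have hinv : Function.Involutive fun x : Fin n → Bool => x ∘ ⇑π := fun x => by
    simp only [Function.comp_assoc, hπ, Function.comp_id]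
  rw [Nat.card_congr (twistedFixEquiv hs hinv), Nat.card_sigma]
  simp only [Nat.card_prod]
end

section
/- Let σ be the permutation of Fin 5 with cycle decomposition (0 1 2)(3 4). The number of monotone functions f : (Fin 5 → Bool) → Bool satisfying f(x ∘ σ) = f(x) for all x equals 35. In the paper's notation: |Fix((123)(45), D_5)| = 35. -/
/-- The pair of weights of `x` on the coordinates `{0, 1, 2}` and `{3, 4}`. -/
def blockWeights (x : Fin 5 → Bool) : Fin 4 × Fin 3 :=
  (⟨(x 0).toNat + (x 1).toNat + (x 2).toNat, by
      have := (x 0).toNat_le; have := (x 1).toNat_le; have := (x 2).toNat_le; omega⟩,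
    ⟨(x 3).toNat + (x 4).toNat, by
      have := (x 3).toNat_le; have := (x 4).toNat_le; omega⟩)

/-- The point of the cube with prescribed block weights whose ones come first in each block. -/
def sortedPoint (p : Fin 4 × Fin 3) : Fin 5 → Bool :=
  ![decide (1 ≤ p.1), decide (2 ≤ p.1), decide (3 ≤ p.1), decide (1 ≤ p.2), decide (2 ≤ p.2)]

/-- Precomposition with the permutation `(0 1 2)(3 4)`. -/
def rotateBlocks (x : Fin 5 → Bool) : Fin 5 → Bool := ![x 1, x 2, x 0, x 4, x 3]

theorem blockWeights_mono : Monotone blockWeights := by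
  intro x y h
  have hle (i : Fin 5) : (x i).toNat ≤ (y i).toNat := Bool.toNat_le_toNat (h i)
  have := hle 0; have := hle 1; have := hle 2; have := hle 3; have := hle 4
  refine Prod.mk_le_mk.2 ⟨Fin.mk_le_mk.2 ?_, Fin.mk_le_mk.2 ?_⟩ <;> omega

theorem sortedPoint_mono : Monotone sortedPoint := by
  have h : ∀ p q : Fin 4 × Fin 3, p.1 ≤ q.1 ∧ p.2 ≤ q.2 →
      ∀ i, sortedPoint p i ≤ sortedPoint q i := by decide +kernel
  exact fun p q hpq => h p q hpq

theorem blockWeights_sortedPoint (p : Fin 4 × Fin 3) : blockWeights (sortedPoint p) = p := by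
  revert p
  decide +kernel

theorem blockWeights_rotateBlocks (x : Fin 5 → Bool) :
    blockWeights (rotateBlocks x) = blockWeights x := by
  revert x
  decide +kernel

theorem exists_iterate_rotateBlocks (x : Fin 5 → Bool) :
    ∃ k : Fin 6, rotateBlocks^[k] x = sortedPoint (blockWeights x) := by
  revert x
  decide +kernel

/-- Monotone functions invariant under `rotateBlocks` are the monotone functions of the block
weights. -/
def invariantMonotoneEquiv :
    {f : (Fin 5 → Bool) → Bool // Monotone f ∧ ∀ x, f (rotateBlocks x) = f x} ≃
      {g : Fin 4 × Fin 3 → Bool // Monotone g} where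
  toFun f := ⟨f.1 ∘ sortedPoint, f.2.1.comp sortedPoint_mono⟩
  invFun g := ⟨g.1 ∘ blockWeights, g.2.comp blockWeights_mono, fun x => by
    simp only [Function.comp_apply, blockWeights_rotateBlocks]⟩
  left_inv := by
    rintro ⟨f, hf, hinv⟩
    ext x
    obtain ⟨k, hk⟩ := exists_iterate_rotateBlocks x
    have hiter (n : ℕ) : f (rotateBlocks^[n] x) = f x := by
      induction n with
      | zero => rfl
      | succ n ih => rw [Function.iterate_succ_apply', hinv, ih]
    simp only [Function.comp_apply, ← hk, hiter]
  right_inv g := by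
    ext p
    simp only [Function.comp_apply, blockWeights_sortedPoint]

theorem card_monotone_fin_four_prod_fin_three :
    Nat.card {g : Fin 4 × Fin 3 → Bool // Monotone g} = 35 := by
  have e : {g : Fin 4 × Fin 3 → Bool // Monotone g} ≃ {g : Fin 4 → Fin 3 → Bool //
      (∀ i : Fin 3, ∀ j, g i.castSucc j ≤ g i.succ j) ∧
      ∀ i, ∀ j : Fin 2, g i j.castSucc ≤ g i j.succ} :=
    (Equiv.curry _ _ _).subtypeEquiv fun g => by
      refine ⟨fun h => ⟨fun i j => h (Prod.mk_le_mk.2 ⟨i.castSucc_le_succ, le_rfl⟩),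
        fun i j => h (Prod.mk_le_mk.2 ⟨le_rfl, j.castSucc_le_succ⟩)⟩, fun h p q hpq => ?_⟩
      have hrow := Fin.monotone_iff_le_succ.2 (fun i => Pi.le_def.2 (h.1 i))
      have hcol := Fin.monotone_iff_le_succ.2 (h.2 q.1)
      exact (hrow hpq.1 p.2).trans (hcol hpq.2)
  rw [Nat.card_congr e, Nat.card_eq_fintype_card]
  decide +kernel

theorem fix_card_123_45_D5 (σ : Equiv.Perm (Fin 5))
    (h0 : σ 0 = 1) (h1 : σ 1 = 2) (h2 : σ 2 = 0) (h3 : σ 3 = 4) (h4 : σ 4 = 3) :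
    Nat.card {f : (Fin 5 → Bool) → Bool //
        Monotone f ∧ ∀ x : Fin 5 → Bool, f (x ∘ ⇑σ) = f x} = 35 := by
  have hσ (x : Fin 5 → Bool) : x ∘ σ = rotateBlocks x := by
    ext i
    fin_cases i <;> simp [rotateBlocks, h0, h1, h2, h3, h4]
  simp only [hσ]
  rw [Nat.card_congr invariantMonotoneEquiv, card_monotone_fin_four_prod_fin_three]
end

section
/- Let σ be the permutation of Fin 4 with cycle decomposition (0 1)(2 3). The number of monotone functions f : (Fin 4 → Bool) → Bool satisfying f(x ∘ σ) = f(x) for all x equals 28. In the paper's notation: |Fix((12)(34), D_4)| = 28. -/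
/-- Representatives of the orbits of `(0 1)(2 3)` on `Fin 4 → Bool`. -/
def orbitRep : Fin 10 → Fin 4 → Bool :=
  ![![false, false, false, false], ![true, false, false, false], ![false, false, true, false],
    ![true, true, false, false], ![false, false, true, true], ![true, false, true, false],
    ![true, false, false, true], ![true, true, true, false], ![true, false, true, true],
    ![true, true, true, true]]

/-- The index of the orbit of `x` under `(0 1)(2 3)`, in the order of `orbitRep`. -/
def orbitIndex (x : Fin 4 → Bool) : Fin 10 :=
  match x 0, x 1, x 2, x 3 with
  | false, false, false, false => 0
  | true, false, false, false | false, true, false, false => 1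
  | false, false, true, false | false, false, false, true => 2
  | true, true, false, false => 3
  | false, false, true, true => 4
  | true, false, true, false | false, true, false, true => 5
  | true, false, false, true | false, true, true, false => 6
  | true, true, true, false | true, true, false, true => 7
  | true, false, true, true | false, true, true, true => 8
  | true, true, true, true => 9

lemma orbitIndex_orbitRep (i : Fin 10) : orbitIndex (orbitRep i) = i := by
  revert i; decide

lemma orbitIndex_swap (x : Fin 4 → Bool) : orbitIndex ![x 1, x 0, x 3, x 2] = orbitIndex x := by
  revert x; decide +kernel

lemma orbitRep_orbitIndex (x : Fin 4 → Bool) :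
    orbitRep (orbitIndex x) = x ∨ orbitRep (orbitIndex x) = ![x 1, x 0, x 3, x 2] := by
  revert x; decide +kernel

/-- Monotonicity along the cover relations of the poset of orbits. -/
def OrbitMonotone (g : Fin 10 → Bool) : Prop :=
  g 0 ≤ g 1 ∧ g 0 ≤ g 2 ∧ g 1 ≤ g 3 ∧ g 1 ≤ g 5 ∧ g 1 ≤ g 6 ∧ g 2 ≤ g 4 ∧ g 2 ≤ g 5 ∧ g 2 ≤ g 6 ∧
    g 3 ≤ g 7 ∧ g 4 ≤ g 8 ∧ g 5 ≤ g 7 ∧ g 5 ≤ g 8 ∧ g 6 ≤ g 7 ∧ g 6 ≤ g 8 ∧ g 7 ≤ g 9 ∧ g 8 ≤ g 9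

instance : DecidablePred OrbitMonotone := fun _ => by unfold OrbitMonotone; infer_instance

lemma card_orbitMonotone : Fintype.card {g : Fin 10 → Bool // OrbitMonotone g} = 28 := by
  decide +kernel

lemma OrbitMonotone.monotone_comp {g : Fin 10 → Bool} (hg : OrbitMonotone g) :
    Monotone (g ∘ orbitIndex) := by
  have key : ∀ g : Fin 10 → Bool, OrbitMonotone g → ∀ x y : Fin 4 → Bool, (∀ k, x k ≤ y k) →
      g (orbitIndex x) ≤ g (orbitIndex y) := by
    decide +kernel
  exact fun x y hxy => key g hg x y hxy

lemma orbitMonotone_of_monotone {g : Fin 10 → Bool} (hg : Monotone (g ∘ orbitIndex)) :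
    OrbitMonotone g := by
  have h (i j : Fin 10) (hij : ∃ y : Fin 4 → Bool, (∀ k, orbitRep i k ≤ y k) ∧ orbitIndex y = j) : g i ≤ g j := by
    obtain ⟨y, hy, rfl⟩ := hij
    simpa [orbitIndex_orbitRep] using hg hy
  refine ⟨?_, ?_, ?_, ?_, ?_, ?_, ?_, ?_, ?_, ?_, ?_, ?_, ?_, ?_, ?_, ?_⟩ <;>
    exact h _ _ (by decide +kernel)

/-- For the permutation `σ` of `Fin 4` with cycle decomposition `(0 1)(2 3)`, the number of monotone functions `f : (Fin 4 → Bool) → Bool` with `f (x ∘ σ) = f x` for all `x` equals 28.  In the paper's notation: `|Fix((12)(34), D_4)| = 28`. -/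
theorem fix_card_12_34_D4 (σ : Equiv.Perm (Fin 4))
    (h0 : σ 0 = 1) (h1 : σ 1 = 0) (h2 : σ 2 = 3) (h3 : σ 3 = 2) :
    Nat.card {f : (Fin 4 → Bool) → Bool //
        Monotone f ∧ ∀ x : Fin 4 → Bool, f (x ∘ ⇑σ) = f x} = 28 := by
  have hσ (x : Fin 4 → Bool) : x ∘ ⇑σ = ![x 1, x 0, x 3, x 2] := by
    ext i; fin_cases i <;> simp [h0, h1, h2, h3]
  have comp_index (f : (Fin 4 → Bool) → Bool) (hf : ∀ x : Fin 4 → Bool, f (x ∘ ⇑σ) = f x) :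
      (f ∘ orbitRep) ∘ orbitIndex = f := by
    ext x
    rcases orbitRep_orbitIndex x with h | h
    · simp [h]
    · simp [h, ← hσ, hf]
  rw [← card_orbitMonotone, ← Nat.card_eq_fintype_card]
  exact Nat.card_congr
    { toFun := fun f => ⟨f.1 ∘ orbitRep, orbitMonotone_of_monotone <| by
        rw [comp_index f.1 f.2.2]; exact f.2.1⟩
      invFun := fun g => ⟨g.1 ∘ orbitIndex, g.2.monotone_comp, fun x => by
        simp [hσ, orbitIndex_swap]⟩
      left_inv := fun f => Subtype.ext (comp_index f.1 f.2.2)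
      right_inv := fun g => Subtype.ext (by ext i; simp [orbitIndex_orbitRep]) }
end

section
/- Let σ be the permutation of Fin 5 given by the 4-cycle (0 1 2 3), fixing 4. The number of monotone functions f : (Fin 5 → Bool) → Bool satisfying f(x ∘ σ) = f(x) for all x equals 35. In the paper's notation: |Fix((1234), D_5)| = 35. -/
/-- Representatives of the orbits of the 4-cycle `(0 1 2 3)` on `Fin 5 → Bool`, indexed by the
rotation class of the first four coordinates and the value of the last one. -/
def cycleOrbitRep (i : Fin 6) (b : Bool) : Fin 5 → Bool :=
  ![decide (1 ≤ i), decide (i = 2 ∨ 4 ≤ i), decide (3 ≤ i), decide (5 ≤ i), b]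

/-- The rotation class of the first four coordinates: classes `2` and `3` are the vectors of
weight two whose ones are adjacent, respectively opposite. -/
def cycleOrbitIndex (x : Fin 5 → Bool) : Fin 6 :=
  if x 0 = x 2 ∧ x 1 = x 3 ∧ x 0 ≠ x 1 then 3
  else ![0, 1, 2, 4, 5] (Fin.ofNat 5 ((x 0).toNat + (x 1).toNat + (x 2).toNat + (x 3).toNat))

theorem cycleOrbitIndex_rep :
    ∀ i b, cycleOrbitIndex (cycleOrbitRep i b) = i ∧ cycleOrbitRep i b 4 = b := by
  decide +kernel

theorem cycleOrbitIndex_rotate : ∀ x : Fin 5 → Bool,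
    cycleOrbitIndex (x ∘ ![1, 2, 3, 0, 4]) = cycleOrbitIndex x := by
  decide +kernel

theorem exists_iterate_rotate_eq_cycleOrbitRep : ∀ x : Fin 5 → Bool, ∃ k : Fin 4,
    (fun y : Fin 5 → Bool => y ∘ ![1, 2, 3, 0, 4])^[k] x =
      cycleOrbitRep (cycleOrbitIndex x) (x 4) := by
  decide +kernel

theorem apply_cycleOrbitRep_index {f : (Fin 5 → Bool) → Bool}
    (hf : ∀ x, f (x ∘ ![1, 2, 3, 0, 4]) = f x) (x : Fin 5 → Bool) :
    f (cycleOrbitRep (cycleOrbitIndex x) (x 4)) = f x := by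
  obtain ⟨k, hk⟩ := exists_iterate_rotate_eq_cycleOrbitRep x
  rw [← hk]
  exact congrFun (Function.iterate_invariant (funext hf) k) x

/-- The order induced on rotation classes by the orbit representatives: a chain, except that the
two classes of weight two are incomparable. -/
def CycleOrbitLE (i j : Fin 6) : Prop := i ≤ j ∧ ¬ (i = 2 ∧ j = 3)

instance (i j : Fin 6) : Decidable (CycleOrbitLE i j) :=
  inferInstanceAs (Decidable (_ ∧ _))

theorem cycleOrbitRep_mono : ∀ i j b c, CycleOrbitLE i j → b ≤ c →
    cycleOrbitRep i b ≤ cycleOrbitRep j c := by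
  simp only [Pi.le_def]
  decide +kernel

theorem cycleOrbitIndex_mono :
    ∀ x y : Fin 5 → Bool, x ≤ y → CycleOrbitLE (cycleOrbitIndex x) (cycleOrbitIndex y) := by
  simp only [Pi.le_def]
  decide +kernel

/-- Monotone Boolean functions on the rotation classes of the first four coordinates. -/
abbrev CycleOrbitMonotone : Type :=
  {g : Fin 6 → Bool // ∀ i j, CycleOrbitLE i j → g i ≤ g j}

/-- A rotation-invariant monotone function is an ordered pair of monotone functions on rotation
classes, namely its restrictions to the two values of the last coordinate. -/
def rotationFixEquiv :
    {f : (Fin 5 → Bool) → Bool // Monotone f ∧ ∀ x, f (x ∘ ![1, 2, 3, 0, 4]) = f x} ≃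
      {p : CycleOrbitMonotone × CycleOrbitMonotone // ∀ i, p.1.1 i ≤ p.2.1 i} where
  toFun f := ⟨(⟨fun i => f.1 (cycleOrbitRep i false),
        fun i j h => f.2.1 (cycleOrbitRep_mono i j _ _ h le_rfl)⟩,
      ⟨fun i => f.1 (cycleOrbitRep i true),
        fun i j h => f.2.1 (cycleOrbitRep_mono i j _ _ h le_rfl)⟩),
    fun i => f.2.1 (cycleOrbitRep_mono i i _ _ ⟨le_rfl, by omega⟩ (Bool.false_le _))⟩
  invFun p := ⟨fun x => cond (x 4) (p.1.2.1 (cycleOrbitIndex x)) (p.1.1.1 (cycleOrbitIndex x)), by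
    refine ⟨fun x y h => ?_, fun x => ?_⟩
    · have hi := cycleOrbitIndex_mono x y h
      have h4 := h 4
      cases hx : x 4 <;> cases hy : y 4 <;> simp only [hx, hy, cond_true, cond_false]
      · exact p.1.1.2 _ _ hi
      · exact (p.2 _).trans (p.1.2.2 _ _ hi)
      · exact absurd (hx ▸ hy ▸ h4 : true ≤ false) (by decide)
      · exact p.1.2.2 _ _ hi
    · simp only [cycleOrbitIndex_rotate]
      rfl⟩
  left_inv f := by
    ext x
    have h := apply_cycleOrbitRep_index f.2.2 x
    cases hx : x 4 <;> simpa [hx] using h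
  right_inv p := by
    ext i <;> simp [cycleOrbitIndex_rep]

theorem card_le_pairs_cycleOrbitMonotone :
    Fintype.card {p : CycleOrbitMonotone × CycleOrbitMonotone // ∀ i, p.1.1 i ≤ p.2.1 i} = 35 := by
  decide +kernel

/-- For the permutation `σ` of `Fin 5` given by the 4-cycle `(0 1 2 3)` fixing `4`, the number of monotone functions `f : (Fin 5 → Bool) → Bool` with `f (x ∘ σ) = f x` for all `x` equals 35.  In the paper's notation: `|Fix((1234), D_5)| = 35`. -/
theorem fix_card_1234_D5 (σ : Equiv.Perm (Fin 5))
    (h0 : σ 0 = 1) (h1 : σ 1 = 2) (h2 : σ 2 = 3) (h3 : σ 3 = 0) (h4 : σ 4 = 4) :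
    Nat.card {f : (Fin 5 → Bool) → Bool //
        Monotone f ∧ ∀ x : Fin 5 → Bool, f (x ∘ ⇑σ) = f x} = 35 := by
  have hσ : ⇑σ = ![1, 2, 3, 0, 4] := by
    ext i
    fin_cases i <;> simp [h0, h1, h2, h3, h4]
  rw [hσ, Nat.card_congr rotationFixEquiv, Nat.card_eq_fintype_card,
    card_le_pairs_cycleOrbitMonotone]
end

section
/- Let σ be the permutation of Fin 7 given by the 5-cycle (0 1 2 3 4), fixing 5 and 6. The number of monotone functions f : (Fin 7 → Bool) → Bool satisfying f(x ∘ σ) = f(x) for all x equals 1548. In the paper's notation: |Fix((12345), D_7)| = 1548. -/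
namespace FiveCycleFix

/-- The index of the orbit of a five-bit word under cyclic rotation. The orbits are listed by
weight; in weights two and three the orbit of a contiguous block comes first. -/
def orbit (y : Fin 5 → Bool) : Fin 8 :=
  match (y 0).toNat + (y 1).toNat + (y 2).toNat + (y 3).toNat + (y 4).toNat with
  | 0 => 0
  | 1 => 1
  | 2 => if ∃ i, y i ∧ y (i + 1) then 2 else 3
  | 3 => if ∃ i, y i ∧ y (i + 1) ∧ y (i + 2) then 4 else 5
  | 4 => 6
  | _ => 7

/-- A representative of each rotation orbit. -/
def representative : Fin 8 → Fin 5 → Bool :=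
  ![![false, false, false, false, false], ![true, false, false, false, false],
    ![true, true, false, false, false], ![true, false, true, false, false],
    ![true, true, true, false, false], ![true, true, false, true, false],
    ![true, true, true, true, false], ![true, true, true, true, true]]

/-- The upper sets of the poset of rotation orbits, as bit masks. -/
def upperSetMask : Fin 11 → ℕ :=
  ![0, 128, 192, 208, 224, 240, 244, 248, 252, 254, 255]

def upperSet (s : Fin 11) (i : Fin 8) : Bool := (upperSetMask s).testBit i

/-- Inclusion of upper sets. -/
def Below (s t : Fin 11) : Prop := upperSetMask s &&& upperSetMask t = upperSetMask s

instance (s t : Fin 11) : Decidable (Below s t) := inferInstanceAs (Decidable (_ = _))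

theorem below_iff : ∀ s t, Below s t ↔ ∀ i, upperSet s i ≤ upperSet t i := by
  decide +kernel

theorem upperSet_injective : Function.Injective upperSet := by
  intro s t h
  have key : ∀ s t, (∀ i, upperSet s i = upperSet t i) → s = t := by decide +kernel
  exact key s t (congrFun h)

theorem eq_vec (y : Fin 5 → Bool) : y = ![y 0, y 1, y 2, y 3, y 4] := by
  funext i; fin_cases i <;> rfl

theorem forall_word {P : (Fin 5 → Bool) → Prop} (h : ∀ a b c d e, P ![a, b, c, d, e])
    (y : Fin 5 → Bool) : P y := by
  rw [eq_vec y]; exact h ..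

theorem orbit_representative : ∀ i, orbit (representative i) = i := by
  decide +kernel

theorem exists_rotation_eq_representative (y : Fin 5 → Bool) :
    ∃ k : Fin 5, (fun i => y (i + k)) = representative (orbit y) := by
  suffices ∃ k : Fin 5, ∀ i, y (i + k) = representative (orbit y) i from
    this.imp fun _ h => funext h
  revert y
  exact forall_word (by decide +kernel)

theorem orbit_rotate (y : Fin 5 → Bool) : orbit (fun i => y (i + 1)) = orbit y := by
  revert y
  exact forall_word (by decide +kernel)

set_option synthInstance.maxHeartbeats 200000 in
set_option synthInstance.maxSize 1000 in
theorem upperSet_orbit_mono (s : Fin 11) {y z : Fin 5 → Bool} (h : y ≤ z) :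
    upperSet s (orbit y) ≤ upperSet s (orbit z) := by
  have key : ∀ a b c d e a' b' c' d' e' : Bool,
      a ≤ a' → b ≤ b' → c ≤ c' → d ≤ d' → e ≤ e' → ∀ s,
      upperSet s (orbit ![a, b, c, d, e]) ≤ upperSet s (orbit ![a', b', c', d', e']) := by
    decide +kernel
  rw [eq_vec y, eq_vec z]
  exact key _ _ _ _ _ _ _ _ _ _ (h 0) (h 1) (h 2) (h 3) (h 4) s

theorem exists_upperSet_eq {g : (Fin 5 → Bool) → Bool} (hg : Monotone g)
    (hr : ∀ y, g y = g (representative (orbit y))) :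
    ∃ s, ∀ i, upperSet s i = g (representative i) := by
  have key : ∀ a0 a1 a2 a3 a4 a5 a6 a7 : Bool,
      a0 ≤ a1 → a1 ≤ a2 → a1 ≤ a3 → a2 ≤ a4 → a2 ≤ a5 → a3 ≤ a4 → a3 ≤ a5 → a4 ≤ a6 →
      a5 ≤ a6 → a6 ≤ a7 →
      ∃ s, ∀ i, upperSet s i = ![a0, a1, a2, a3, a4, a5, a6, a7] i := by
    decide +kernel
  have le (i j : Fin 8) (h : ∀ k, representative i k ≤ representative j k) :
      g (representative i) ≤ g (representative j) := hg h
  have h35 : g (representative 3) ≤ g (representative 5) := by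
    have h : g ![false, true, false, true, false] ≤ g (representative 5) :=
      hg (show ∀ k, _ from by decide +kernel)
    rwa [hr, show orbit ![false, true, false, true, false] = 3 by decide +kernel] at h
  obtain ⟨s, hs⟩ := key (g (representative 0)) (g (representative 1)) (g (representative 2))
    (g (representative 3)) (g (representative 4)) (g (representative 5)) (g (representative 6))
    (g (representative 7)) (le _ _ (by decide +kernel)) (le _ _ (by decide +kernel))
    (le _ _ (by decide +kernel)) (le _ _ (by decide +kernel)) (le _ _ (by decide +kernel))
    (le _ _ (by decide +kernel)) h35 (le _ _ (by decide +kernel)) (le _ _ (by decide +kernel))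
    (le _ _ (by decide +kernel))
  refine ⟨s, fun i => (hs i).trans ?_⟩
  fin_cases i <;> rfl

/-- Append two bits to a five-bit word. -/
def glue (y : Fin 5 → Bool) (p q : Bool) : Fin 7 → Bool :=
  ![y 0, y 1, y 2, y 3, y 4, p, q]

/-- The first five bits of a seven-bit word. -/
def front (x : Fin 7 → Bool) : Fin 5 → Bool := ![x 0, x 1, x 2, x 3, x 4]

theorem glue_front (x : Fin 7 → Bool) : glue (front x) (x 5) (x 6) = x := by
  funext i; fin_cases i <;> rfl

theorem front_glue (y : Fin 5 → Bool) (p q : Bool) : front (glue y p q) = y :=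
  (eq_vec y).symm

theorem front_mono {x x' : Fin 7 → Bool} (h : x ≤ x') : front x ≤ front x' := by
  intro i; fin_cases i <;> exact h _

theorem glue_mono {y y' : Fin 5 → Bool} {p p' q q' : Bool} (hy : y ≤ y') (hp : p ≤ p')
    (hq : q ≤ q') : glue y p q ≤ glue y' p' q' := by
  intro i
  fin_cases i
  exacts [hy 0, hy 1, hy 2, hy 3, hy 4, hp, hq]

/-- Quadruples of upper sets that form a monotone map from the square of `Bool`. -/
abbrev MonotoneSquare : Type :=
  {t : Fin 11 × Fin 11 × Fin 11 × Fin 11 //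
    (Below t.1 t.2.1 ∧ Below t.1 t.2.2.1) ∧ Below t.2.1 t.2.2.2 ∧ Below t.2.2.1 t.2.2.2}

def corner (t : Fin 11 × Fin 11 × Fin 11 × Fin 11) : Bool → Bool → Fin 11
  | false, false => t.1
  | false, true => t.2.1
  | true, false => t.2.2.1
  | true, true => t.2.2.2

theorem corner_mono (t : MonotoneSquare) {p p' q q' : Bool} (hp : p ≤ p') (hq : q ≤ q')
    (i : Fin 8) : upperSet (corner t.1 p q) i ≤ upperSet (corner t.1 p' q') i := by
  obtain ⟨⟨a, b, c, d⟩, ⟨hab, hac⟩, hbd, hcd⟩ := t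
  have hab := (below_iff _ _).1 hab i
  have hac := (below_iff _ _).1 hac i
  have hbd := (below_iff _ _).1 hbd i
  have hcd := (below_iff _ _).1 hcd i
  cases p <;> cases p' <;> cases q <;> cases q' <;>
    first
    | exact absurd hp (by decide)
    | exact absurd hq (by decide)
    | exact le_rfl
    | assumption
    | exact hab.trans hbd

/-- The monotone function encoded by a monotone square of upper sets. -/
def decode (t : MonotoneSquare) (x : Fin 7 → Bool) : Bool :=
  upperSet (corner t.1 (x 5) (x 6)) (orbit (front x))

theorem decode_monotone (t : MonotoneSquare) : Monotone (decode t) := fun _ _ h =>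
  (corner_mono t (h 5) (h 6) _).trans (upperSet_orbit_mono _ (front_mono h))

theorem decode_injective : Function.Injective decode := by
  intro t u h
  have hc (p q : Bool) : corner t.1 p q = corner u.1 p q := by
    refine upperSet_injective (funext fun i => ?_)
    have := congrFun h (glue (representative i) p q)
    simp only [decode, front_glue, orbit_representative] at this
    exact this
  exact Subtype.ext (Prod.ext (hc false false) (Prod.ext (hc false true)
    (Prod.ext (hc true false) (hc true true))))

section

variable {σ : Equiv.Perm (Fin 7)} (h0 : σ 0 = 1) (h1 : σ 1 = 2) (h2 : σ 2 = 3) (h3 : σ 3 = 4)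
  (h4 : σ 4 = 0) (h5 : σ 5 = 5) (h6 : σ 6 = 6)

include h0 h1 h2 h3 h4

theorem front_comp (x : Fin 7 → Bool) : front (x ∘ σ) = fun i => front x (i + 1) := by
  funext i
  fin_cases i
  exacts [congrArg x h0, congrArg x h1, congrArg x h2, congrArg x h3, congrArg x h4]

include h5 h6

theorem decode_comp (t : MonotoneSquare) (x : Fin 7 → Bool) : decode t (x ∘ σ) = decode t x := by
  simp only [decode, front_comp h0 h1 h2 h3 h4, orbit_rotate, Function.comp_apply, h5, h6]

theorem glue_comp (y : Fin 5 → Bool) (p q : Bool) :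
    glue y p q ∘ σ = glue (fun i => y (i + 1)) p q := by
  rw [← glue_front (glue y p q ∘ σ), front_comp h0 h1 h2 h3 h4, front_glue]
  simp only [Function.comp_apply, h5, h6]
  rfl

theorem apply_glue_representative {f : (Fin 7 → Bool) → Bool} (hf : ∀ x, f (x ∘ σ) = f x)
    (p q : Bool) (y : Fin 5 → Bool) :
    f (glue y p q) = f (glue (representative (orbit y)) p q) := by
  have rot : ∀ (k : ℕ) (y : Fin 5 → Bool),
      f (glue (fun i => y (i + Fin.ofNat 5 k)) p q) = f (glue y p q) := by
    intro k
    induction k with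
    | zero => intro y; simp
    | succ k ih =>
      intro y
      have hk : ∀ i : Fin 5, i + Fin.ofNat 5 (k + 1) = i + 1 + Fin.ofNat 5 k := by
        intro i
        apply Fin.ext
        simp only [Fin.val_add, Fin.val_ofNat, Fin.val_one]
        omega
      simp only [hk]
      rw [← glue_comp h0 h1 h2 h3 h4 h5 h6 (fun i => y (i + Fin.ofNat 5 k)), hf, ih]
  obtain ⟨k, hk⟩ := exists_rotation_eq_representative y
  rw [← hk, ← rot k y, Fin.ofNat_val_eq_self]

theorem exists_decode_eq {f : (Fin 7 → Bool) → Bool} (hm : Monotone f)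
    (hf : ∀ x, f (x ∘ σ) = f x) : ∃ t, decode t = f := by
  have hr := apply_glue_representative h0 h1 h2 h3 h4 h5 h6 hf
  have hs (p q : Bool) : ∃ s, ∀ i, upperSet s i = f (glue (representative i) p q) :=
    exists_upperSet_eq (g := fun y => f (glue y p q))
      (fun _ _ h => hm (glue_mono h le_rfl le_rfl)) (hr p q)
  choose s hs using hs
  have below {p p' q q' : Bool} (hp : p ≤ p') (hq : q ≤ q') : Below (s p q) (s p' q') := by
    rw [below_iff]
    intro i
    rw [hs, hs]
    exact hm (glue_mono le_rfl hp hq)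
  refine ⟨⟨(s false false, s false true, s true false, s true true),
    ⟨below (by decide) (by decide), below (by decide) (by decide)⟩,
    below (by decide) (by decide), below (by decide) (by decide)⟩, funext fun x => ?_⟩
  have hc (p q : Bool) :
      corner (s false false, s false true, s true false, s true true) p q = s p q := by
    cases p <;> cases q <;> rfl
  rw [decode, hc, hs, ← hr, glue_front]

end

theorem card_monotoneSquare : Fintype.card MonotoneSquare = 1548 := by
  decide +kernel

end FiveCycleFix

/-- For the permutation `σ` of `Fin 7` given by the 5-cycle `(0 1 2 3 4)` fixing `5` and `6`, the number of monotone functions `f : (Fin 7 → Bool) → Bool` with `f (x ∘ σ) = f x` for all `x` equals 1548.  In the paper's notation: `|Fix((12345), D_7)| = 1548`. -/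
theorem fix_card_12345_D7 (σ : Equiv.Perm (Fin 7))
    (h0 : σ 0 = 1) (h1 : σ 1 = 2) (h2 : σ 2 = 3) (h3 : σ 3 = 4) (h4 : σ 4 = 0) (h5 : σ 5 = 5) (h6 : σ 6 = 6) :
    Nat.card {f : (Fin 7 → Bool) → Bool //
        Monotone f ∧ ∀ x : Fin 7 → Bool, f (x ∘ ⇑σ) = f x} = 1548 := by
  rw [← FiveCycleFix.card_monotoneSquare, ← Nat.card_eq_fintype_card]
  symm
  refine Nat.card_congr (Equiv.ofBijective
    (fun t => ⟨FiveCycleFix.decode t, FiveCycleFix.decode_monotone t,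
      FiveCycleFix.decode_comp h0 h1 h2 h3 h4 h5 h6 t⟩) ⟨?_, ?_⟩)
  · intro t u h
    exact FiveCycleFix.decode_injective (congrArg Subtype.val h)
  · rintro ⟨f, hm, hf⟩
    obtain ⟨t, ht⟩ := FiveCycleFix.exists_decode_eq h0 h1 h2 h3 h4 h5 h6 hm hf
    exact ⟨t, Subtype.ext ht⟩
end

section
/- Let σ be the permutation of Fin 8 with cycle decomposition (0 1 2 3 4)(5 6 7). The number of monotone functions f : (Fin 8 → Bool) → Bool satisfying f(x ∘ σ) = f(x) for all x equals 870. In the paper's notation: |Fix((12345)(678), D_8)| = 870. -/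
namespace FixCount

/-- The permutation `(0 1 2 3 4)(5 6 7)` as a function. -/
def rot : Fin 8 → Fin 8 := ![1, 2, 3, 4, 0, 6, 7, 5]

/-- The orbits of the cyclic rotation on `Fin 5 → Bool`, numbered by increasing weight. -/
def necklace (y : Fin 5 → Bool) : Fin 8 :=
  let adj := ∑ i, (y i && y (i + 1)).toNat
  match ∑ i, (y i).toNat with
  | 0 => 0
  | 1 => 1
  | 2 => if adj = 1 then 2 else 3
  | 3 => if adj = 2 then 4 else 5
  | 4 => 6
  | _ => 7

/-- The weight of a binary word of length three, which determines its orbit under rotation. -/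
def weight (z : Fin 3 → Bool) : Fin 4 := Fin.ofNat 4 (∑ i, (z i).toNat)

/-- The weight of the necklaces in a given class. -/
def rank : Fin 8 → ℕ := ![0, 1, 2, 2, 3, 3, 4, 5]

/-- The order induced on necklace classes by the pointwise order on words. -/
def NecklaceLE (i j : Fin 8) : Prop := i = j ∨ rank i < rank j

instance : DecidableRel NecklaceLE := fun _ _ => inferInstanceAs (Decidable (_ ∨ _))

/-- The orbit of a word of length eight, as a pair of orbits. -/
def orbit (x : Fin 8 → Bool) : Fin 4 × Fin 8 :=
  (weight fun i => x (Fin.natAdd 5 i), necklace fun i => x (Fin.castAdd 3 i))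

/-- A representative of each orbit. -/
def rep (i : Fin 4) (j : Fin 8) (k : Fin 8) : Bool :=
  Nat.testBit ((![0, 1, 3, 5, 7, 11, 15, 31] : Fin 8 → ℕ) j + 32 * (2 ^ (i : ℕ) - 1)) k

/-- The eleven upper sets of necklace classes, as bit masks. -/
def mask : Fin 11 → ℕ := ![0, 128, 192, 208, 224, 240, 244, 248, 252, 254, 255]

/-- Inclusion of upper sets of necklace classes. -/
def MaskLE (a b : Fin 11) : Prop := mask a &&& mask b = mask a

instance : DecidableRel MaskLE := fun _ _ => inferInstanceAs (Decidable (_ = _))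

/-- The indicator function of an upper set of necklace classes. -/
def upper (a : Fin 11) (j : Fin 8) : Bool := (mask a).testBit j

/-- Increasing chains of four upper sets of necklace classes. -/
abbrev Chain : Type :=
  {c : Fin 11 × Fin 11 × Fin 11 × Fin 11 //
    MaskLE c.1 c.2.1 ∧ MaskLE c.2.1 c.2.2.1 ∧ MaskLE c.2.2.1 c.2.2.2}

/-- The members of a quadruple, as a family. -/
def member (c : Fin 11 × Fin 11 × Fin 11 × Fin 11) : Fin 4 → Fin 11 :=
  ![c.1, c.2.1, c.2.2.1, c.2.2.2]

lemma orbit_rep : ∀ i j, orbit (rep i j) = (i, j) := by decide +kernel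

lemma orbit_comp_rot : ∀ x : Fin 8 → Bool, orbit (fun k => x (rot k)) = orbit x := by
  decide +kernel

lemma exists_rep_rotate : ∀ x : Fin 8 → Bool, ∃ n : Fin 15,
    ∀ k, rep (orbit x).1 (orbit x).2 (rot^[n] k) = x k := by
  decide +kernel

lemma exists_rep_rotate_le : ∀ i i' : Fin 4, ∀ j j' : Fin 8, i ≤ i' → NecklaceLE j j' →
    ∃ n : Fin 15, ∀ k, rep i j (rot^[n] k) ≤ rep i' j' k := by
  decide +kernel

lemma weight_mono : ∀ x y : Fin 3 → Bool, (∀ k, x k ≤ y k) → weight x ≤ weight y := by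
  decide +kernel

lemma necklace_mono : ∀ x y : Fin 5 → Bool, (∀ k, x k ≤ y k) →
    NecklaceLE (necklace x) (necklace y) := by
  decide +kernel

lemma upper_mono : ∀ a i j, NecklaceLE i j → upper a i ≤ upper a j := by decide +kernel

lemma exists_upper : ∀ u : Fin 8 → Bool, (∀ i j, NecklaceLE i j → u i ≤ u j) →
    ∃ a, ∀ j, upper a j = u j := by
  decide +kernel

lemma maskLE_iff : ∀ a b, MaskLE a b ↔ ∀ j, upper a j ≤ upper b j := by decide +kernel

lemma upper_injective : ∀ a b, (∀ j, upper a j = upper b j) → a = b := by decide +kernel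

lemma card_chain : Fintype.card Chain = 870 := by decide +kernel

lemma upper_member_mono (c : Chain) {i i' : Fin 4} (h : i ≤ i') (j : Fin 8) :
    upper (member c.1 i) j ≤ upper (member c.1 i') j := by
  obtain ⟨⟨a, b, c, d⟩, h₁, h₂, h₃⟩ := c
  refine (Fin.monotone_iff_le_succ (f := fun i => upper (member (a, b, c, d) i) j)).2 ?_ h
  intro i
  fin_cases i
  · exact (maskLE_iff _ _).1 h₁ j
  · exact (maskLE_iff _ _).1 h₂ j
  · exact (maskLE_iff _ _).1 h₃ j

/-- The invariant function attached to a chain of upper sets. -/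
def toFun (c : Chain) (x : Fin 8 → Bool) : Bool := upper (member c.1 (orbit x).1) (orbit x).2

lemma toFun_monotone (c : Chain) : Monotone (toFun c) := fun _ _ h =>
  (upper_mono _ _ _ (necklace_mono _ _ fun _ => h _)).trans
    (upper_member_mono c (weight_mono _ _ fun _ => h _) _)

lemma toFun_comp_rot (c : Chain) (x : Fin 8 → Bool) : toFun c (x ∘ rot) = toFun c x := by
  have h : orbit (x ∘ rot) = orbit x := orbit_comp_rot x
  rw [toFun, h, toFun]

lemma toFun_rep (c : Chain) (i : Fin 4) (j : Fin 8) :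
    toFun c (rep i j) = upper (member c.1 i) j := by
  simp only [toFun, orbit_rep]

lemma toFun_injective : Function.Injective toFun := by
  intro c c' h
  have key (i : Fin 4) : member c.1 i = member c'.1 i :=
    upper_injective _ _ fun j => by rw [← toFun_rep, h, toFun_rep]
  exact Subtype.ext (Prod.ext (key 0) (Prod.ext (key 1) (Prod.ext (key 2) (key 3))))

lemma apply_iterate_rot {f : (Fin 8 → Bool) → Bool} (hf : ∀ x, f (x ∘ rot) = f x)
    (x : Fin 8 → Bool) (n : ℕ) : f (fun k => x (rot^[n] k)) = f x := by
  induction n with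
  | zero => rfl
  | succ n ih => exact (hf fun k => x (rot^[n] k)).trans ih

lemma exists_toFun_eq {f : (Fin 8 → Bool) → Bool} (hm : Monotone f)
    (hf : ∀ x, f (x ∘ rot) = f x) : ∃ c, toFun c = f := by
  have mono (i i' j j') (hi : i ≤ i') (hj : NecklaceLE j j') :
      f (rep i j) ≤ f (rep i' j') := by
    obtain ⟨n, hn⟩ := exists_rep_rotate_le i i' j j' hi hj
    rw [← apply_iterate_rot hf (rep i j) n]
    exact hm hn
  choose a ha using fun i => exists_upper (fun j => f (rep i j)) fun j j' hj =>
    mono i i j j' le_rfl hj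
  have hle (i i' : Fin 4) (hi : i ≤ i') : MaskLE (a i) (a i') :=
    (maskLE_iff _ _).2 fun j => by
      rw [ha, ha]
      exact mono i i' j j hi (Or.inl rfl)
  refine ⟨⟨(a 0, a 1, a 2, a 3), hle 0 1 (by decide), hle 1 2 (by decide),
    hle 2 3 (by decide)⟩, funext fun x => ?_⟩
  have hmem (i : Fin 4) : member (a 0, a 1, a 2, a 3) i = a i := by
    fin_cases i <;> rfl
  obtain ⟨n, hn⟩ := exists_rep_rotate x
  rw [toFun, hmem, ha, ← apply_iterate_rot hf _ n]
  exact congrArg f (funext hn)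

end FixCount


/-- For the permutation `σ` of `Fin 8` with cycle decomposition `(0 1 2 3 4)(5 6 7)`, the number of monotone functions `f : (Fin 8 → Bool) → Bool` with `f (x ∘ σ) = f x` for all `x` equals 870.  In the paper's notation: `|Fix((12345)(678), D_8)| = 870`. -/
theorem fix_card_12345_678_D8 (σ : Equiv.Perm (Fin 8))
    (h0 : σ 0 = 1) (h1 : σ 1 = 2) (h2 : σ 2 = 3) (h3 : σ 3 = 4) (h4 : σ 4 = 0) (h5 : σ 5 = 6) (h6 : σ 6 = 7) (h7 : σ 7 = 5) :
    Nat.card {f : (Fin 8 → Bool) → Bool //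
        Monotone f ∧ ∀ x : Fin 8 → Bool, f (x ∘ ⇑σ) = f x} = 870 := by
  have hσ : ⇑σ = FixCount.rot := by
    funext k
    fin_cases k <;> assumption
  rw [hσ, ← FixCount.card_chain, ← Nat.card_eq_fintype_card]
  refine (Nat.card_congr (Equiv.ofBijective (fun c => ⟨FixCount.toFun c,
    FixCount.toFun_monotone c, FixCount.toFun_comp_rot c⟩) ⟨?_, ?_⟩)).symm
  · intro c c' h
    exact FixCount.toFun_injective (congrArg Subtype.val h)
  · intro f
    obtain ⟨c, hc⟩ := FixCount.exists_toFun_eq f.2.1 f.2.2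
    exact ⟨c, Subtype.ext hc⟩
end
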